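/- Let B_ϱ ⋐ B_r ⊂ ℝⁿ be concentric open balls with r ≤ 1, let p, t ∈ (1, ∞), s ∈ (1, 2), N ≥ 1, and let f : B_r → ℝ^N be continuously differentiable with ‖f‖_{W^{s,p}(B_r)} := ‖f‖_{L^p(B_r)} + ‖Df‖_{L^p(B_r)} + [Df]_{s−1,p;B_r} < ∞ and with ‖f‖_{L^{2t}(B_r)} < ∞. Set p̃ := 2pst/(p(s−1) + 2t). Then there exist constants c > 0 and κ > 0, depending only on n, p, s, t, such that ‖f‖_{L^{p̃}(B_ϱ)} + ‖Df‖_{L^{p̃}(B_ϱ)} ≤ c (r − ϱ)^{−κ} ‖f‖_{L^{2t}(B_r)}^{(s−1)/s} ‖f‖_{W^{s,p}(B_r)}^{1/s}. -/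

import Mathlib

open MeasureTheory
open scoped ENNReal

/-- The Gagliardo seminorm `[g]_{σ,p;U}` of a map `g : U ⊆ ℝⁿ → F`. -/
noncomputable def gagliardoSeminorm {n : ℕ} {F : Type*} [NormedAddCommGroup F]
    (U : Set (EuclideanSpace ℝ (Fin n))) (g : EuclideanSpace ℝ (Fin n) → F) (σ p : ℝ) : ℝ≥0∞ :=
  (∫⁻ x in U, ∫⁻ y in U,
      (‖g x - g y‖₊ : ℝ≥0∞) ^ p / edist x y ^ ((n : ℝ) + σ * p)) ^ (1 / p)

/-- The `L^p(U)` norm of a map `g : U ⊆ ℝⁿ → F`. -/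
noncomputable def lpNormOn {n : ℕ} {F : Type*} [NormedAddCommGroup F]
    (U : Set (EuclideanSpace ℝ (Fin n))) (g : EuclideanSpace ℝ (Fin n) → F) (p : ℝ) : ℝ≥0∞ :=
  (∫⁻ x in U, (‖g x‖₊ : ℝ≥0∞) ^ p) ^ (1 / p)

/-- The `W^{s,p}(U)` norm `‖f‖_{L^p} + ‖Df‖_{L^p} + [Df]_{s-1,p;U}` for `s ∈ (1,2)`. -/
noncomputable def wNormOn {n N : ℕ} (U : Set (EuclideanSpace ℝ (Fin n)))
    (f : EuclideanSpace ℝ (Fin n) → EuclideanSpace ℝ (Fin N)) (s p : ℝ) : ℝ≥0∞ :=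
  lpNormOn U f p + lpNormOn U (fun x => fderiv ℝ f x) p +
    gagliardoSeminorm U (fun x => fderiv ℝ f x) (s - 1) p

/-- Layer cake representation of `a ^ q` for an extended nonnegative real `a`. -/
theorem ENNReal.rpow_eq_lintegral_indicator_lt (a : ℝ≥0∞) {q : ℝ} (hq : 0 < q) :
    a ^ q = ENNReal.ofReal q * ∫⁻ l in Set.Ioi (0 : ℝ),
      {l : ℝ | ENNReal.ofReal l < a}.indicator (fun l => ENNReal.ofReal (l ^ (q - 1))) l := by
  have hms : MeasurableSet {l : ℝ | ENNReal.ofReal l < a} :=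
    measurableSet_lt ENNReal.measurable_ofReal measurable_const
  rw [lintegral_indicator hms, Measure.restrict_restrict hms]
  have hnn : ∀ s ⊆ Set.Ioi (0 : ℝ), MeasurableSet s →
      0 ≤ᵐ[volume.restrict s] fun l : ℝ => l ^ (q - 1) := fun s hs hms =>
    (ae_restrict_iff' hms).2 (Filter.Eventually.of_forall fun l hl =>
      Real.rpow_nonneg (le_of_lt (hs hl)) _)
  have hm : Measurable fun l : ℝ => l ^ (q - 1) := by fun_prop
  induction a with
  | top =>
    have : {l : ℝ | ENNReal.ofReal l < ⊤} ∩ Set.Ioi 0 = Set.Ioi 0 := by ext; simp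
    rw [this, ENNReal.top_rpow_of_pos hq]
    have h : ∫⁻ l in Set.Ioi (0 : ℝ), ENNReal.ofReal (l ^ (q - 1)) = ⊤ := by
      by_contra h
      rw [← ne_eq, lintegral_ofReal_ne_top_iff_integrable hm.aestronglyMeasurable
        (hnn _ subset_rfl measurableSet_Ioi)] at h
      exact not_integrableOn_Ioi_rpow _ h
    rw [h, ENNReal.mul_top (by simpa using hq)]
  | coe b =>
    have : {l : ℝ | ENNReal.ofReal l < b} ∩ Set.Ioi 0 = Set.Ioo 0 (b : ℝ) := by
      ext l
      simp only [Set.mem_inter_iff, Set.mem_ofPred_eq, Set.mem_Ioi, Set.mem_Ioo, and_comm]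
      refine and_congr_left fun hl => ?_
      rw [ENNReal.ofReal_lt_coe_iff hl.le]
    have hint : IntervalIntegrable (fun l : ℝ => l ^ (q - 1)) volume 0 b :=
      intervalIntegral.intervalIntegrable_rpow' (by linarith)
    rw [this, ← ofReal_integral_eq_lintegral_ofReal
      (((intervalIntegrable_iff_integrableOn_Ioo_of_le b.coe_nonneg).1 hint))
      (hnn _ Set.Ioo_subset_Ioi_self measurableSet_Ioo), ← integral_Ioc_eq_integral_Ioo,
      ← intervalIntegral.integral_of_le b.coe_nonneg, integral_rpow (Or.inl (by linarith)),
      ← ENNReal.ofReal_mul hq.le, sub_add_cancel, Real.zero_rpow hq.ne', sub_zero,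
      mul_div_cancel₀ _ hq.ne', ← ENNReal.ofReal_rpow_of_nonneg b.coe_nonneg hq.le,
      ENNReal.ofReal_coe_nnreal]

section Maximal

variable {E : Type*} [NormedAddCommGroup E] [MeasurableSpace E]

/-- The uncentred Hardy–Littlewood maximal function over balls of radius at most one. -/
noncomputable def localMaximal (μ : Measure E) (g : E → ℝ≥0∞) (x : E) : ℝ≥0∞ :=
  ⨆ b : E × Set.Ioc (0 : ℝ) 1, (Metric.ball b.1 (b.2 : ℝ)).indicator
    (fun _ => (μ (Metric.ball b.1 (b.2 : ℝ)))⁻¹ * ∫⁻ y in Metric.ball b.1 (b.2 : ℝ), g y ∂μ) x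

theorem average_le_localMaximal (μ : Measure E) (g : E → ℝ≥0∞) (x : E) {ρ : ℝ} (hρ : 0 < ρ)
    (hρ1 : ρ ≤ 1) :
    (μ (Metric.ball x ρ))⁻¹ * ∫⁻ y in Metric.ball x ρ, g y ∂μ ≤ localMaximal μ g x := by
  refine le_trans ?_ (le_iSup _ ((x, ⟨ρ, hρ, hρ1⟩) : E × Set.Ioc (0 : ℝ) 1))
  simp [hρ]

theorem exists_ball_of_lt_localMaximal {μ : Measure E} {g : E → ℝ≥0∞} {x : E} {l : ℝ≥0∞}
    (h : l < localMaximal μ g x) :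
    ∃ b : E × Set.Ioc (0 : ℝ) 1, x ∈ Metric.ball b.1 (b.2 : ℝ) ∧
      l < (μ (Metric.ball b.1 (b.2 : ℝ)))⁻¹ * ∫⁻ y in Metric.ball b.1 (b.2 : ℝ), g y ∂μ := by
  obtain ⟨b, hb⟩ := lt_iSup_iff.1 h
  have hx : x ∈ Metric.ball b.1 (b.2 : ℝ) := Set.mem_of_indicator_ne_zero (ne_bot_of_gt hb)
  exact ⟨b, hx, by rwa [Set.indicator_of_mem hx] at hb⟩

theorem measurable_localMaximal [BorelSpace E] (μ : Measure E) (g : E → ℝ≥0∞) :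
    Measurable (localMaximal μ g) :=
  (lowerSemicontinuous_iSup fun _ =>
    Metric.isOpen_ball.lowerSemicontinuous_indicator zero_le).measurable

variable [NormedSpace ℝ E] [FiniteDimensional ℝ E] [BorelSpace E] [Nontrivial E]
  (μ : Measure E) [μ.IsAddHaarMeasure]

/-- Weak type `(1,1)` bound for the maximal function. -/
theorem mul_measure_lt_localMaximal_le (g : E → ℝ≥0∞) (l : ℝ≥0∞) :
    l * μ {x | l < localMaximal μ g x} ≤ 5 ^ Module.finrank ℝ E * ∫⁻ y, g y ∂μ := by
  set t : Set (E × Set.Ioc (0 : ℝ) 1) := {b | l < (μ (Metric.ball b.1 (b.2 : ℝ)))⁻¹ *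
    ∫⁻ y in Metric.ball b.1 (b.2 : ℝ), g y ∂μ} with ht
  obtain ⟨u, hut, hdisj, hcov⟩ := Vitali.exists_disjoint_subfamily_covering_enlargement_closedBall
    t (fun b => b.1) (fun b => (b.2 : ℝ)) 1 (fun b _ => b.2.2.2) 5 (by norm_num)
  have hucount : u.Countable := hdisj.countable_of_nonempty_interior fun b _ =>
    ⟨b.1, Metric.ball_subset_interior_closedBall (Metric.mem_ball_self b.2.2.1)⟩
  have hsub : {x | l < localMaximal μ g x} ⊆
      ⋃ b ∈ u, Metric.closedBall b.1 (5 * (b.2 : ℝ)) := by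
    intro x hx
    obtain ⟨b, hxb, hb⟩ := exists_ball_of_lt_localMaximal hx
    obtain ⟨b', hb', hs⟩ := hcov b hb
    exact Set.mem_biUnion hb' (hs (Metric.ball_subset_closedBall hxb))
  have hterm : ∀ b ∈ u, l * μ (Metric.closedBall b.1 (5 * (b.2 : ℝ))) ≤
      5 ^ Module.finrank ℝ E * ∫⁻ y in Metric.closedBall b.1 (b.2 : ℝ), g y ∂μ := by
    intro b hb
    have hpos := b.2.2.1
    have h1 : μ (Metric.closedBall b.1 (5 * (b.2 : ℝ))) =
        5 ^ Module.finrank ℝ E * μ (Metric.ball b.1 (b.2 : ℝ)) := by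
      rw [Measure.addHaar_closedBall μ _ (by positivity), Measure.addHaar_ball μ _ hpos.le,
        mul_pow, ENNReal.ofReal_mul (by positivity), ENNReal.ofReal_pow (by norm_num), mul_assoc]
      simp
    have h2 : l * μ (Metric.ball b.1 (b.2 : ℝ)) ≤
        ∫⁻ y in Metric.ball b.1 (b.2 : ℝ), g y ∂μ := by
      have h3 : l < _ := hut hb
      rw [mul_comm, ← div_eq_mul_inv] at h3
      exact ENNReal.mul_le_of_le_div h3.le
    rw [h1, mul_left_comm]
    gcongr
    exact h2.trans (lintegral_mono_set Metric.ball_subset_closedBall)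
  calc l * μ {x | l < localMaximal μ g x}
      ≤ l * ∑' b : u, μ (Metric.closedBall b.1.1 (5 * (b.1.2 : ℝ))) := by
        gcongr
        exact (measure_mono hsub).trans (measure_biUnion_le μ hucount _)
    _ = ∑' b : u, l * μ (Metric.closedBall b.1.1 (5 * (b.1.2 : ℝ))) := ENNReal.tsum_mul_left.symm
    _ ≤ ∑' b : u, 5 ^ Module.finrank ℝ E *
          ∫⁻ y in Metric.closedBall b.1.1 (b.1.2 : ℝ), g y ∂μ :=
        ENNReal.tsum_le_tsum fun b => hterm b.1 b.2
    _ = 5 ^ Module.finrank ℝ E *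
          ∫⁻ y in ⋃ b ∈ u, Metric.closedBall b.1 (b.2 : ℝ), g y ∂μ := by
        rw [ENNReal.tsum_mul_left, lintegral_biUnion hucount
          (fun _ _ => Metric.isClosed_closedBall.measurableSet) hdisj]
    _ ≤ 5 ^ Module.finrank ℝ E * ∫⁻ y, g y ∂μ := by
        gcongr
        exact Measure.restrict_le_self

theorem mul_measure_lt_localMaximal_le_setLIntegral {g : E → ℝ≥0∞} (hg : Measurable g)
    (l : ℝ≥0∞) :
    l * μ {x | l < localMaximal μ g x} ≤
      2 * 5 ^ Module.finrank ℝ E * ∫⁻ y in {y | l < 2 * g y}, g y ∂μ := by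
  have hms : MeasurableSet {y | l < 2 * g y} := measurableSet_lt measurable_const (by fun_prop)
  set h : E → ℝ≥0∞ := {y | l < 2 * g y}.indicator g with hh
  have hgh : ∀ y, g y ≤ h y + l / 2 := by
    intro y
    by_cases hy : l < 2 * g y
    · simp [hh, Set.indicator_of_mem (show y ∈ {y | l < 2 * g y} from hy)]
    · rw [hh, Set.indicator_of_notMem (show y ∉ {y | l < 2 * g y} from hy), zero_add,
        ENNReal.le_div_iff_mul_le (by simp) (by simp), mul_comm]
      exact not_lt.1 hy
  have hsub : {x | l < localMaximal μ g x} ⊆ {x | l / 2 < localMaximal μ h x} := by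
    intro x hx
    obtain ⟨b, hxb, hb⟩ := exists_ball_of_lt_localMaximal hx
    have hpos := b.2.2.1
    have h0 : μ (Metric.ball b.1 (b.2 : ℝ)) ≠ 0 := (Metric.measure_ball_pos μ _ hpos).ne'
    have h1 : μ (Metric.ball b.1 (b.2 : ℝ)) ≠ ⊤ := measure_ball_lt_top.ne
    have h2 : (μ (Metric.ball b.1 (b.2 : ℝ)))⁻¹ * ∫⁻ y in Metric.ball b.1 (b.2 : ℝ), g y ∂μ ≤
        (μ (Metric.ball b.1 (b.2 : ℝ)))⁻¹ * (∫⁻ y in Metric.ball b.1 (b.2 : ℝ), h y ∂μ)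
          + l / 2 := by
      calc _ ≤ (μ (Metric.ball b.1 (b.2 : ℝ)))⁻¹ *
            ∫⁻ y in Metric.ball b.1 (b.2 : ℝ), (h y + l / 2) ∂μ := by
            gcongr with y
            exact hgh y
        _ = _ := by
            rw [lintegral_add_right _ measurable_const, mul_add, setLIntegral_const,
              mul_comm (l / 2), ← mul_assoc, ENNReal.inv_mul_cancel h0 h1, one_mul]
    have h3 : (μ (Metric.ball b.1 (b.2 : ℝ)))⁻¹ * ∫⁻ y in Metric.ball b.1 (b.2 : ℝ), h y ∂μ ≤
        localMaximal μ h x := by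
      refine le_trans ?_ (le_iSup _ b)
      simp [hxb]
    have h4 : l / 2 + l / 2 < localMaximal μ h x + l / 2 := by
      rw [ENNReal.add_halves]
      exact hb.trans_le (h2.trans (by gcongr))
    exact lt_of_add_lt_add_right h4
  calc l * μ {x | l < localMaximal μ g x}
      = 2 * (l / 2 * μ {x | l < localMaximal μ g x}) := by
        rw [← mul_assoc, ENNReal.mul_div_cancel (by simp) (by simp)]
    _ ≤ 2 * (l / 2 * μ {x | l / 2 < localMaximal μ h x}) := by
        gcongr 2 * (_ * ?_)
        exact measure_mono hsub
    _ ≤ 2 * (5 ^ Module.finrank ℝ E * ∫⁻ y, h y ∂μ) := by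
        gcongr 2 * ?_
        exact mul_measure_lt_localMaximal_le μ h _
    _ = _ := by rw [hh, lintegral_indicator hms, mul_assoc]

/-- Strong type `(q,q)` bound for the maximal function. -/
theorem lintegral_localMaximal_rpow_le {g : E → ℝ≥0∞} (hg : Measurable g) {q : ℝ} (hq : 1 < q) :
    ∫⁻ x, localMaximal μ g x ^ q ∂μ ≤ ENNReal.ofReal (q / (q - 1) * 2 ^ q *
      5 ^ Module.finrank ℝ E) * ∫⁻ x, g x ^ q ∂μ := by
  have hM := measurable_localMaximal μ g
  have hq1 : 0 < q - 1 := by linarith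
  set A : ℝ≥0∞ := 2 * 5 ^ Module.finrank ℝ E with hA
  have hslice : ∀ l ∈ Set.Ioi (0 : ℝ),
      ∫⁻ x, {x | ENNReal.ofReal l < localMaximal μ g x}.indicator
        (fun _ => ENNReal.ofReal (l ^ (q - 1))) x ∂μ ≤
      A * ∫⁻ x, {x | ENNReal.ofReal l < 2 * g x}.indicator
        (fun x => ENNReal.ofReal (l ^ (q - 1 - 1)) * g x) x ∂μ := by
    intro l hl
    have hl0 : (0 : ℝ) < l := hl
    rw [lintegral_indicator (measurableSet_lt measurable_const hM), setLIntegral_const,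
      lintegral_indicator (measurableSet_lt measurable_const (by fun_prop)),
      lintegral_const_mul _ hg]
    have hpow : ENNReal.ofReal (l ^ (q - 1)) =
        ENNReal.ofReal (l ^ (q - 1 - 1)) * ENNReal.ofReal l := by
      rw [← ENNReal.ofReal_mul (by positivity), ← Real.rpow_add_one hl0.ne', sub_add_cancel]
    rw [hpow, mul_assoc, mul_left_comm A]
    gcongr ENNReal.ofReal (l ^ (q - 1 - 1)) * ?_
    exact mul_measure_lt_localMaximal_le_setLIntegral μ hg _
  have hmeas₁ : Measurable (Function.uncurry fun (x : E) (l : ℝ) =>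
      {l : ℝ | ENNReal.ofReal l < localMaximal μ g x}.indicator
        (fun l => ENNReal.ofReal (l ^ (q - 1))) l) := by
    refine (Measurable.indicator (f := fun z : E × ℝ => ENNReal.ofReal (z.2 ^ (q - 1)))
      (s := {z : E × ℝ | ENNReal.ofReal z.2 < localMaximal μ g z.1}) (by fun_prop)
      (measurableSet_lt (by fun_prop) (by fun_prop)))
  have hmeas₂ : Measurable (Function.uncurry fun (l : ℝ) (x : E) =>
      {x | ENNReal.ofReal l < 2 * g x}.indicator
        (fun x => ENNReal.ofReal (l ^ (q - 1 - 1)) * g x) x) := by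
    refine (Measurable.indicator (f := fun z : ℝ × E => ENNReal.ofReal (z.1 ^ (q - 1 - 1)) * g z.2)
      (s := {z : ℝ × E | ENNReal.ofReal z.1 < 2 * g z.2}) (by fun_prop)
      (measurableSet_lt (by fun_prop) (by fun_prop)))
  have hcollapse : ∀ x, ENNReal.ofReal (q - 1) * ∫⁻ l in Set.Ioi (0 : ℝ),
      {x | ENNReal.ofReal l < 2 * g x}.indicator
        (fun x => ENNReal.ofReal (l ^ (q - 1 - 1)) * g x) x = 2 ^ (q - 1) * g x ^ q := by
    intro x
    have h1 : ∀ l : ℝ, {x | ENNReal.ofReal l < 2 * g x}.indicator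
        (fun x => ENNReal.ofReal (l ^ (q - 1 - 1)) * g x) x =
        {l : ℝ | ENNReal.ofReal l < 2 * g x}.indicator
          (fun l => ENNReal.ofReal (l ^ (q - 1 - 1))) l * g x := by
      intro l
      by_cases h : ENNReal.ofReal l < 2 * g x <;> simp [Set.indicator, h]
    simp_rw [h1]
    rw [lintegral_mul_const _ ((Measurable.indicator (by fun_prop)
      (measurableSet_lt ENNReal.measurable_ofReal measurable_const))), ← mul_assoc,
      ← ENNReal.rpow_eq_lintegral_indicator_lt _ hq1, ENNReal.mul_rpow_of_nonneg _ _ hq1.le,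
      mul_assoc]
    congr 1
    nth_rewrite 2 [← ENNReal.rpow_one (g x)]
    rw [← ENNReal.rpow_add_of_nonneg _ _ hq1.le zero_le_one, sub_add_cancel]
  calc ∫⁻ x, localMaximal μ g x ^ q ∂μ
      = ENNReal.ofReal q * ∫⁻ x, (∫⁻ l in Set.Ioi (0 : ℝ),
        {l : ℝ | ENNReal.ofReal l < localMaximal μ g x}.indicator
          (fun l => ENNReal.ofReal (l ^ (q - 1))) l) ∂μ := by
        rw [← lintegral_const_mul _ hmeas₁.lintegral_prod_right]
        exact lintegral_congr fun x => ENNReal.rpow_eq_lintegral_indicator_lt _ (by linarith)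
    _ = ENNReal.ofReal q * ∫⁻ l in Set.Ioi (0 : ℝ), ∫⁻ x,
        {x | ENNReal.ofReal l < localMaximal μ g x}.indicator
          (fun _ => ENNReal.ofReal (l ^ (q - 1))) x ∂μ := by
        rw [lintegral_lintegral_swap hmeas₁.aemeasurable]
        rfl
    _ ≤ ENNReal.ofReal q * ∫⁻ l in Set.Ioi (0 : ℝ), A * ∫⁻ x,
        {x | ENNReal.ofReal l < 2 * g x}.indicator
          (fun x => ENNReal.ofReal (l ^ (q - 1 - 1)) * g x) x ∂μ := by
        gcongr ENNReal.ofReal q * ?_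
        exact setLIntegral_mono' measurableSet_Ioi hslice
    _ = ENNReal.ofReal q * (A * ∫⁻ x, (∫⁻ l in Set.Ioi (0 : ℝ),
        {x | ENNReal.ofReal l < 2 * g x}.indicator
          (fun x => ENNReal.ofReal (l ^ (q - 1 - 1)) * g x) x) ∂μ) := by
        rw [lintegral_const_mul _ hmeas₂.lintegral_prod_right,
          lintegral_lintegral_swap hmeas₂.aemeasurable]
    _ = ENNReal.ofReal q * (A * ∫⁻ x, (ENNReal.ofReal (q - 1))⁻¹ *
          (2 ^ (q - 1) * g x ^ q) ∂μ) := by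
        congr 2
        refine lintegral_congr fun x => ?_
        rw [← hcollapse, ← mul_assoc, ENNReal.inv_mul_cancel (by simpa using hq1) (by simp),
          one_mul]
    _ = _ := by
        rw [lintegral_const_mul _ (by fun_prop), lintegral_const_mul _ (by fun_prop)]
        have : ENNReal.ofReal (q / (q - 1) * 2 ^ q * 5 ^ Module.finrank ℝ E) =
            ENNReal.ofReal q * (A * ((ENNReal.ofReal (q - 1))⁻¹ * 2 ^ (q - 1))) := by
          rw [hA, show (2 : ℝ≥0∞) = ENNReal.ofReal 2 by simp,
            show (5 : ℝ≥0∞) = ENNReal.ofReal 5 by simp, ← ENNReal.ofReal_inv_of_pos hq1,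
            ENNReal.ofReal_rpow_of_pos two_pos, ← ENNReal.ofReal_pow (by norm_num),
            ← ENNReal.ofReal_mul (by positivity), ← ENNReal.ofReal_mul (by positivity),
            ← ENNReal.ofReal_mul (by positivity), ← ENNReal.ofReal_mul (by linarith)]
          congr 1
          have : (2 : ℝ) ^ q = 2 ^ (q - 1) * 2 := by
            rw [← Real.rpow_add_one two_ne_zero, sub_add_cancel]
          rw [this]
          ring
        rw [this]
        ring

end Maximal

theorem setLIntegral_ball_add_le {E : Type*} [NormedAddCommGroup E] [MeasurableSpace E]
    [BorelSpace E] (μ : Measure E) [μ.IsAddRightInvariant] (g : E → ℝ≥0∞) (x v : E) {ρ ρ' : ℝ} (h : ρ + ‖v‖ ≤ ρ') :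
    ∫⁻ y in Metric.ball x ρ, g (y + v) ∂μ ≤ ∫⁻ y in Metric.ball x ρ', g y ∂μ := by
  rw [← lintegral_indicator Metric.isOpen_ball.measurableSet,
    ← lintegral_indicator Metric.isOpen_ball.measurableSet,
    ← lintegral_add_right_eq_self ((Metric.ball x ρ').indicator g) v]
  refine lintegral_mono fun y => ?_
  by_cases hy : y ∈ Metric.ball x ρ
  · have hyv : y + v ∈ Metric.ball x ρ' := by
      rw [mem_ball_iff_norm] at hy ⊢
      calc ‖y + v - x‖ = ‖(y - x) + v‖ := by congr 1; abel
        _ ≤ ‖y - x‖ + ‖v‖ := norm_add_le _ _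
        _ < ρ' := by linarith
    rw [Set.indicator_of_mem hy, Set.indicator_of_mem hyv]
  · rw [Set.indicator_of_notMem hy]
    exact zero_le

section Pointwise

variable {E F : Type*} [NormedAddCommGroup E] [NormedSpace ℝ E] [NormedAddCommGroup F]
  [NormedSpace ℝ F]

theorem ContinuousLinearMap.enorm_le_of_unit_norm (A : E →L[ℝ] F) {C : ℝ≥0∞}
    (h : ∀ e, ‖e‖ = 1 → ‖A e‖ₑ ≤ C) : ‖A‖ₑ ≤ C := by
  induction C with
  | top => exact le_top
  | coe C =>
    rw [enorm_le_coe]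
    refine A.opNorm_le_of_unit_norm C.coe_nonneg fun e he => ?_
    have := h e he
    rw [enorm_le_coe] at this
    exact this

/-- Comparison of the increment of `f` along a segment with that of a linear map. -/
theorem enorm_apply_le_lintegral_segment [CompleteSpace F] {f : E → F} {U : Set E} (hU : IsOpen U)
    (hUc : Convex ℝ U) (hf : ContDiffOn ℝ 1 f U) {y v : E} (hy : y ∈ U) (hyv : y + v ∈ U)
    (A : E →L[ℝ] F) :
    ‖A v‖ₑ ≤ ‖f (y + v)‖ₑ + ‖f y‖ₑ +
      ∫⁻ τ in Set.Ioc (0 : ℝ) 1, ‖v‖ₑ * ‖fderiv ℝ f (y + τ • v) - A‖ₑ := by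
  have hmem : ∀ τ ∈ Set.Icc (0 : ℝ) 1, y + τ • v ∈ U := fun τ hτ =>
    hUc.add_smul_mem hy hyv hτ
  have hderiv : ∀ τ ∈ Set.uIcc (0 : ℝ) 1, HasDerivAt (fun τ : ℝ => f (y + τ • v) - τ • A v)
      ((fderiv ℝ f (y + τ • v) - A) v) τ := by
    intro τ hτ
    rw [Set.uIcc_of_le zero_le_one] at hτ
    have h1 : HasFDerivAt f (fderiv ℝ f (y + τ • v)) (y + τ • v) :=
      ((hf.contDiffAt (hU.mem_nhds (hmem τ hτ))).differentiableAt one_ne_zero).hasFDerivAt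
    have h2 : HasDerivAt (fun τ : ℝ => y + τ • v) v τ := by
      simpa using ((hasDerivAt_id τ).smul_const v).const_add y
    have h3 : HasDerivAt (fun τ : ℝ => τ • A v) (A v) τ := by
      simpa using (hasDerivAt_id τ).smul_const (A v)
    exact (h1.comp_hasDerivAt τ h2).sub h3
  have hcont : ContinuousOn (fun τ : ℝ => (fderiv ℝ f (y + τ • v) - A) v) (Set.uIcc 0 1) := by
    rw [Set.uIcc_of_le zero_le_one]
    have h1 : ContinuousOn (fun τ : ℝ => fderiv ℝ f (y + τ • v)) (Set.Icc 0 1) :=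
      (hf.continuousOn_fderiv_of_isOpen hU le_rfl).comp (by fun_prop) hmem
    exact (h1.sub continuousOn_const).clm_apply continuousOn_const
  have hFTC := intervalIntegral.integral_eq_sub_of_hasDerivAt hderiv hcont.intervalIntegrable
  have hAv : A v = f (y + v) - f y - ∫ τ in (0 : ℝ)..1, (fderiv ℝ f (y + τ • v) - A) v := by
    rw [hFTC]
    simp only [one_smul, zero_smul, add_zero, sub_zero]
    abel
  rw [hAv]
  refine (enorm_sub_le).trans (add_le_add enorm_sub_le ?_)
  rw [intervalIntegral.integral_of_le zero_le_one]
  refine (enorm_integral_le_lintegral_enorm _).trans (lintegral_mono fun τ => ?_)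
  rw [mul_comm]
  exact ContinuousLinearMap.le_opENorm _ _

variable [FiniteDimensional ℝ E] [MeasurableSpace E] [BorelSpace E]
  [FiniteDimensional ℝ F] (μ : Measure E) [μ.IsAddHaarMeasure]

theorem enorm_apply_mul_measure_ball_le {f : E → F} {x v : E} {ρ : ℝ} (hv : ‖v‖ = ρ)
    (hf : ContDiffOn ℝ 1 f (Metric.ball x (2 * ρ))) (A : E →L[ℝ] F) :
    ‖A v‖ₑ * μ (Metric.ball x ρ) ≤ 2 * ∫⁻ y in Metric.ball x (2 * ρ), ‖f y‖ₑ ∂μ +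
      ‖v‖ₑ * ∫⁻ y in Metric.ball x (2 * ρ), ‖fderiv ℝ f y - A‖ₑ ∂μ := by
  have hρ : 0 ≤ ρ := hv ▸ norm_nonneg v
  have hsub : Metric.ball x ρ ⊆ Metric.ball x (2 * ρ) := Metric.ball_subset_ball (by linarith)
  have hmeas : Measurable (Function.uncurry fun (y : E) (τ : ℝ) =>
      ‖v‖ₑ * ‖fderiv ℝ f (y + τ • v) - A‖ₑ) := by
    have h1 : Measurable fun z : E × ℝ => fderiv ℝ f (z.1 + z.2 • v) :=
      (measurable_fderiv ℝ f).comp (by fun_prop)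
    exact ((h1.sub_const A).enorm).const_mul _
  have hfm : AEMeasurable (fun y => ‖f y‖ₑ) (μ.restrict (Metric.ball x ρ)) := by
    borelize F
    exact ((hf.continuousOn.mono hsub).aemeasurable Metric.isOpen_ball.measurableSet).enorm
  calc ‖A v‖ₑ * μ (Metric.ball x ρ) = ∫⁻ _ in Metric.ball x ρ, ‖A v‖ₑ ∂μ := by
        rw [setLIntegral_const]
    _ ≤ ∫⁻ y in Metric.ball x ρ, (‖f (y + v)‖ₑ + ‖f y‖ₑ +
          ∫⁻ τ in Set.Ioc (0 : ℝ) 1, ‖v‖ₑ * ‖fderiv ℝ f (y + τ • v) - A‖ₑ) ∂μ := by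
        refine setLIntegral_mono' Metric.isOpen_ball.measurableSet fun y hy => ?_
        refine enorm_apply_le_lintegral_segment Metric.isOpen_ball (convex_ball x (2 * ρ)) hf
          (hsub hy) ?_ A
        rw [mem_ball_iff_norm] at hy ⊢
        calc ‖y + v - x‖ = ‖(y - x) + v‖ := by congr 1; abel
          _ ≤ ‖y - x‖ + ‖v‖ := norm_add_le _ _
          _ < 2 * ρ := by linarith
    _ = ∫⁻ y in Metric.ball x ρ, ‖f (y + v)‖ₑ ∂μ + ∫⁻ y in Metric.ball x ρ, ‖f y‖ₑ ∂μ +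
          ∫⁻ τ in Set.Ioc (0 : ℝ) 1, ‖v‖ₑ *
            ∫⁻ y in Metric.ball x ρ, ‖fderiv ℝ f (y + τ • v) - A‖ₑ ∂μ := by
        rw [lintegral_add_right _ hmeas.lintegral_prod_right, lintegral_add_right' _ hfm,
          lintegral_lintegral_swap hmeas.aemeasurable]
        congr 1
        refine lintegral_congr fun τ => ?_
        rw [lintegral_const_mul]
        have h1 : Measurable fun y : E => fderiv ℝ f (y + τ • v) :=
          (measurable_fderiv ℝ f).comp (by fun_prop)
        exact (h1.sub_const A).enorm
    _ ≤ ∫⁻ y in Metric.ball x (2 * ρ), ‖f y‖ₑ ∂μ + ∫⁻ y in Metric.ball x (2 * ρ), ‖f y‖ₑ ∂μ +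
          ∫⁻ _ in Set.Ioc (0 : ℝ) 1, ‖v‖ₑ *
            ∫⁻ y in Metric.ball x (2 * ρ), ‖fderiv ℝ f y - A‖ₑ ∂μ := by
        refine add_le_add (add_le_add ?_ (lintegral_mono_set hsub)) ?_
        · exact setLIntegral_ball_add_le μ (fun y => ‖f y‖ₑ) x v (by linarith)
        · refine setLIntegral_mono' measurableSet_Ioc fun τ hτ => ?_
          gcongr ‖v‖ₑ * ?_
          refine setLIntegral_ball_add_le μ (fun y => ‖fderiv ℝ f y - A‖ₑ) x (τ • v) ?_
          rw [norm_smul, Real.norm_of_nonneg hτ.1.le, hv]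
          nlinarith [hτ.2]
    _ = _ := by simp [two_mul]

variable [Nontrivial E]

/-- Bound of a linear map `A` by averages of `f` and of the oscillation of the
derivative. -/
theorem enorm_le_average_add_average_fderiv_sub {f : E → F} {x : E} {R : ℝ} (hR : 0 < R)
    (hf : ContDiffOn ℝ 1 f (Metric.ball x R)) (A : E →L[ℝ] F) :
    ‖A‖ₑ ≤ 2 ^ (Module.finrank ℝ E + 2) *
      ((ENNReal.ofReal R)⁻¹ * ((μ (Metric.ball x R))⁻¹ * ∫⁻ y in Metric.ball x R, ‖f y‖ₑ ∂μ) +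
        (μ (Metric.ball x R))⁻¹ * ∫⁻ y in Metric.ball x R, ‖fderiv ℝ f y - A‖ₑ ∂μ) := by
  refine A.enorm_le_of_unit_norm fun e he => ?_
  obtain ⟨ρ, rfl⟩ : ∃ ρ, R = 2 * ρ := ⟨R / 2, by ring⟩
  have hρ : 0 < ρ := by linarith
  have hv : ‖ρ • e‖ = ρ := by rw [norm_smul, he, mul_one, Real.norm_of_nonneg hρ.le]
  have hve : ‖ρ • e‖ₑ = ENNReal.ofReal ρ := by rw [← ofReal_norm, hv]
  have key := enorm_apply_mul_measure_ball_le μ hv hf A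
  rw [hve, map_smul, enorm_smul, Real.enorm_of_nonneg hρ.le] at key
  set I := ∫⁻ y in Metric.ball x (2 * ρ), ‖f y‖ₑ ∂μ
  set J := ∫⁻ y in Metric.ball x (2 * ρ), ‖fderiv ℝ f y - A‖ₑ ∂μ
  set m := μ (Metric.ball x ρ) with hm
  have hm0 : m ≠ 0 := (Metric.measure_ball_pos μ _ hρ).ne'
  have hmt : m ≠ ⊤ := measure_ball_lt_top.ne
  have hm2 : μ (Metric.ball x (2 * ρ)) = 2 ^ Module.finrank ℝ E * m := by
    rw [hm, Measure.addHaar_ball μ _ hR.le, Measure.addHaar_ball μ _ hρ.le, mul_pow,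
      ENNReal.ofReal_mul (by positivity), ENNReal.ofReal_pow (by norm_num), mul_assoc]
    simp
  set a := ENNReal.ofReal ρ with ha
  have ha0 : a ≠ 0 := by simpa [ha] using hρ
  have hat : a ≠ ⊤ := ENNReal.ofReal_ne_top
  have ha2 : ENNReal.ofReal (2 * ρ) = 2 * a := by
    rw [ENNReal.ofReal_mul (by norm_num)]; simp [ha]
  set D := (2 : ℝ≥0∞) ^ Module.finrank ℝ E with hD
  have hD0 : D ≠ 0 := by simp [hD]
  have hDt : D ≠ ⊤ := by simp [hD]
  rw [hm2, ha2, ENNReal.mul_inv (Or.inl hD0) (Or.inl hDt),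
    ENNReal.mul_inv (Or.inl two_ne_zero) (Or.inl (by simp))]
  have hle : ‖A e‖ₑ ≤ a⁻¹ * m⁻¹ * (2 * I + a * J) := by
    calc ‖A e‖ₑ = (a⁻¹ * a) * (m⁻¹ * m) * ‖A e‖ₑ := by
          rw [ENNReal.inv_mul_cancel ha0 hat, ENNReal.inv_mul_cancel hm0 hmt]; simp
      _ = a⁻¹ * m⁻¹ * (a * ‖A e‖ₑ * m) := by ring
      _ ≤ _ := by gcongr
  refine hle.trans ?_
  calc a⁻¹ * m⁻¹ * (2 * I + a * J) = 2 * (a⁻¹ * m⁻¹ * I) + (a⁻¹ * a) * (m⁻¹ * J) := by ring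
    _ = 2 * (a⁻¹ * m⁻¹ * I) + m⁻¹ * J := by rw [ENNReal.inv_mul_cancel ha0 hat, one_mul]
    _ ≤ 2 * (a⁻¹ * m⁻¹ * I) + 4 * (m⁻¹ * J) := by
        exact add_le_add le_rfl (le_mul_of_one_le_left zero_le (by norm_num))
    _ = (D * D⁻¹) * ((2 * 2⁻¹) * 2 * (a⁻¹ * m⁻¹ * I) + 4 * (m⁻¹ * J)) := by
        rw [ENNReal.mul_inv_cancel hD0 hDt, ENNReal.mul_inv_cancel two_ne_zero (by simp)]
        simp
    _ = _ := by rw [pow_add]; ring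

theorem average_le_rpow_mul_lintegral_div {h : E → ℝ≥0∞} (hh : Measurable h) {x : E} (hx : h x = 0)
    {R p σ : ℝ} (hR : 0 < R) (hp : 1 < p) (hσ : 0 < σ) :
    (μ (Metric.ball x R))⁻¹ * ∫⁻ y in Metric.ball x R, h y ∂μ ≤
      (μ (Metric.ball 0 1))⁻¹ ^ (1 / p) * (ENNReal.ofReal R ^ σ *
        (∫⁻ y in Metric.ball x R, h y ^ p / edist x y ^ ((Module.finrank ℝ E : ℝ) + σ * p) ∂μ) ^
          (1 / p)) := by
  have hp0 : 0 < p := by linarith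
  set d : ℝ := (Module.finrank ℝ E : ℝ)
  have hk : 0 < d + σ * p := by positivity
  set m := μ (Metric.ball x R) with hm
  have hm0 : m ≠ 0 := (Metric.measure_ball_pos μ _ hR).ne'
  have hmt : m ≠ ⊤ := measure_ball_lt_top.ne
  set a := ENNReal.ofReal R with ha
  have ha0 : a ≠ 0 := by simpa [ha] using hR
  have hat : a ≠ ⊤ := ENNReal.ofReal_ne_top
  have hma : m = a ^ d * μ (Metric.ball 0 1) := by
    rw [hm, Measure.addHaar_ball μ _ hR.le, ENNReal.ofReal_pow hR.le, ENNReal.rpow_natCast]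
  set G := ∫⁻ y in Metric.ball x R, h y ^ p / edist x y ^ (d + σ * p) ∂μ
  have hJensen : ∫⁻ y in Metric.ball x R, h y ∂μ ≤
      (∫⁻ y in Metric.ball x R, h y ^ p ∂μ) ^ (1 / p) * m ^ (1 - 1 / p) := by
    have := ENNReal.lintegral_mul_norm_pow_le (μ := μ.restrict (Metric.ball x R))
      (f := fun y => h y ^ p) (g := fun _ => 1) (hh.pow_const p).aemeasurable
      aemeasurable_const (p := 1 / p) (q := 1 - 1 / p) (by positivity)
      (by rw [sub_nonneg, div_le_one hp0]; exact hp.le) (by ring)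
    simpa [← ENNReal.rpow_mul, hp0.ne'] using this
  have hpt : ∫⁻ y in Metric.ball x R, h y ^ p ∂μ ≤ a ^ (d + σ * p) * G := by
    rw [← lintegral_const_mul' _ _ (ENNReal.rpow_ne_top_of_nonneg hk.le hat)]
    refine setLIntegral_mono' Metric.isOpen_ball.measurableSet fun y hy => ?_
    by_cases hxy : x = y
    · subst hxy
      rw [hx, ENNReal.zero_rpow_of_pos hp0]
      exact zero_le
    · have he0 : edist x y ≠ 0 := by simpa using hxy
      have hle : edist x y ≤ a := by
        rw [edist_comm, edist_dist]
        exact ENNReal.ofReal_le_ofReal (Metric.mem_ball.1 hy).le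
      have hk0 : edist x y ^ (d + σ * p) ≠ 0 := by simp [he0, hk.not_gt]
      have hkt : edist x y ^ (d + σ * p) ≠ ⊤ :=
        ENNReal.rpow_ne_top_of_nonneg hk.le (edist_ne_top x y)
      calc h y ^ p = edist x y ^ (d + σ * p) * (h y ^ p / edist x y ^ (d + σ * p)) := by
            rw [ENNReal.mul_div_cancel hk0 hkt]
        _ ≤ _ := by gcongr
  calc m⁻¹ * ∫⁻ y in Metric.ball x R, h y ∂μ
      ≤ m⁻¹ * ((a ^ (d + σ * p) * G) ^ (1 / p) * m ^ (1 - 1 / p)) := by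
        gcongr
        exact hJensen.trans (by gcongr)
    _ = (m⁻¹ * a ^ (d + σ * p) * G) ^ (1 / p) := by
        rw [ENNReal.rpow_sub _ _ hm0 hmt, ENNReal.rpow_one, mul_assoc m⁻¹,
          ENNReal.mul_rpow_of_nonneg m⁻¹ _ (by positivity), ENNReal.inv_rpow, div_eq_mul_inv m]
        calc _ = (m⁻¹ * m) * ((m ^ (1 / p))⁻¹ * (a ^ (d + σ * p) * G) ^ (1 / p)) := by ring
          _ = _ := by rw [ENNReal.inv_mul_cancel hm0 hmt, one_mul]
    _ = ((μ (Metric.ball 0 1))⁻¹ * ((a ^ σ) ^ p * G)) ^ (1 / p) := by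
        have had0 : a ^ d ≠ 0 := (ENNReal.rpow_pos (pos_iff_ne_zero.2 ha0) hat).ne'
        have hadt : a ^ d ≠ ⊤ := ENNReal.rpow_ne_top_of_nonneg (by positivity) hat
        rw [hma, ENNReal.rpow_add _ _ ha0 hat, ENNReal.mul_inv (Or.inl had0) (Or.inl hadt),
          ← ENNReal.rpow_mul]
        congr 1
        calc _ = ((a ^ d)⁻¹ * a ^ d) * ((μ (Metric.ball 0 1))⁻¹ * (a ^ (σ * p) * G)) := by ring
          _ = _ := by rw [ENNReal.inv_mul_cancel had0 hadt, one_mul]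
    _ = _ := by
        rw [ENNReal.mul_rpow_of_nonneg _ _ (by positivity),
          ENNReal.mul_rpow_of_nonneg _ _ (by positivity), ← ENNReal.rpow_mul (a ^ σ),
          mul_one_div_cancel hp0.ne', ENNReal.rpow_one]

end Pointwise

/-- Optimisation over the scale `R` in an additive interpolation inequality. -/
theorem ENNReal.le_rpow_mul_rpow_of_forall_le {a K M H D : ℝ≥0∞} {s : ℝ} (hs : 1 < s)
    (hK : K ≠ ⊤) (hH : H ≠ ⊤) (haH : a ≤ D * H)
    (h : ∀ R : ℝ, 0 < R → a ≤
      K * ((ENNReal.ofReal R)⁻¹ * M + ENNReal.ofReal R ^ (s - 1) * H)) :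
    a ≤ 2 * K * (M ^ ((s - 1) / s) * H ^ (1 / s)) := by
  have hs0 : 0 < s := by linarith
  have hs1 : 0 < s - 1 := by linarith
  rcases eq_or_ne H 0 with rfl | hH0
  · rw [mul_zero] at haH
    exact haH.trans zero_le
  rcases eq_or_ne M 0 with rfl | hM0
  · have h0 : a ≤ 0 := by
      have hlim : Filter.Tendsto (fun R : ℝ => K * (ENNReal.ofReal R ^ (s - 1) * H))
          (nhdsWithin 0 (Set.Ioi 0)) (nhds 0) := by
        have h1 : Filter.Tendsto (fun R : ℝ => ENNReal.ofReal R ^ (s - 1))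
            (nhdsWithin 0 (Set.Ioi 0)) (nhds 0) := by
          have : Continuous fun R : ℝ => ENNReal.ofReal R ^ (s - 1) :=
            ENNReal.continuous_rpow_const.comp ENNReal.continuous_ofReal
          simpa [ENNReal.zero_rpow_of_pos hs1] using
            (this.tendsto 0).mono_left nhdsWithin_le_nhds
        have h2 := ENNReal.Tendsto.mul_const h1 (Or.inr hH)
        have h3 := ENNReal.Tendsto.const_mul h2 (Or.inr hK)
        simpa using h3
      refine ge_of_tendsto hlim ?_
      filter_upwards [self_mem_nhdsWithin] with R hR
      simpa using h R hR
    exact h0.trans zero_le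
  rcases eq_or_ne K 0 with rfl | hK0
  · simpa using h 1 one_pos
  rcases eq_or_ne M ⊤ with rfl | hMt
  · have : (2 * K * ((⊤ : ℝ≥0∞) ^ ((s - 1) / s) * H ^ (1 / s))) = ⊤ := by
      rw [ENNReal.top_rpow_of_pos (by positivity),
        ENNReal.top_mul (ENNReal.rpow_pos (pos_iff_ne_zero.2 hH0) hH).ne',
        ENNReal.mul_top (by simpa using hK0)]
    rw [this]
    exact le_top
  have hMHt : (M / H) ^ (1 / s) ≠ ⊤ :=
    ENNReal.rpow_ne_top_of_nonneg (by positivity) (ENNReal.div_ne_top hMt hH0)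
  have hMH0 : (M / H) ^ (1 / s) ≠ 0 := (ENNReal.rpow_pos
    (ENNReal.div_pos hM0 hH) (ENNReal.div_ne_top hMt hH0)).ne'
  have key := h ((M / H) ^ (1 / s)).toReal (ENNReal.toReal_pos hMH0 hMHt)
  rw [ENNReal.ofReal_toReal hMHt] at key
  have e1 : ((M / H) ^ (1 / s))⁻¹ * M = M ^ ((s - 1) / s) * H ^ (1 / s) := by
    rw [ENNReal.div_rpow_of_nonneg _ _ (by positivity), ENNReal.inv_div
      (Or.inl (ENNReal.rpow_ne_top_of_nonneg (by positivity) hH))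
      (Or.inl (ENNReal.rpow_pos (pos_iff_ne_zero.2 hH0) hH).ne'),
      show (s - 1) / s = 1 - 1 / s by field_simp, ENNReal.rpow_sub _ _ hM0 hMt,
      ENNReal.rpow_one, div_eq_mul_inv (H ^ _), div_eq_mul_inv M]
    ring
  have e2 : ((M / H) ^ (1 / s)) ^ (s - 1) * H = M ^ ((s - 1) / s) * H ^ (1 / s) := by
    rw [← ENNReal.rpow_mul, one_div_mul_eq_div, ENNReal.div_rpow_of_nonneg _ _ (by positivity),
      show 1 / s = 1 - (s - 1) / s by field_simp; ring, ENNReal.rpow_sub _ _ hH0 hH,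
      ENNReal.rpow_one, div_eq_mul_inv (M ^ _), div_eq_mul_inv H]
    ring
  rw [e1, e2] at key
  exact key.trans_eq (by ring)

/-- Hölder interpolation of a product of powers. -/
theorem lintegral_rpow_mul_rpow_interpolation {α : Type*} [MeasurableSpace α] {μ : Measure α}
    {u v : α → ℝ≥0∞} (hu : AEMeasurable u μ) (hv : AEMeasurable v μ) {q p P θ η : ℝ} (hq : 0 < q)
    (hp : 0 < p) (hP : 0 < P) (hθ : 0 ≤ θ) (hη : 0 ≤ η) (h : η * P / q + θ * P / p = 1) :
    (∫⁻ x, (u x ^ η * v x ^ θ) ^ P ∂μ) ^ (1 / P) ≤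
      ((∫⁻ x, u x ^ q ∂μ) ^ (1 / q)) ^ η * ((∫⁻ x, v x ^ p ∂μ) ^ (1 / p)) ^ θ := by
  have key := ENNReal.lintegral_mul_norm_pow_le (μ := μ) (f := fun x => u x ^ q)
    (g := fun x => v x ^ p) (hu.pow_const q) (hv.pow_const p) (p := η * P / q) (q := θ * P / p)
    (by positivity) (by positivity) h
  have e1 : ∀ x, (u x ^ q) ^ (η * P / q) * (v x ^ p) ^ (θ * P / p) =
      (u x ^ η * v x ^ θ) ^ P := by
    intro x
    rw [ENNReal.mul_rpow_of_nonneg _ _ hP.le, ← ENNReal.rpow_mul, ← ENNReal.rpow_mul,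
      ← ENNReal.rpow_mul, ← ENNReal.rpow_mul, mul_div_cancel₀ _ hq.ne', mul_div_cancel₀ _ hp.ne']
  simp_rw [e1] at key
  refine (ENNReal.rpow_le_rpow key (by positivity : 0 ≤ 1 / P)).trans_eq ?_
  rw [ENNReal.mul_rpow_of_nonneg _ _ (by positivity), ← ENNReal.rpow_mul, ← ENNReal.rpow_mul,
    ← ENNReal.rpow_mul, ← ENNReal.rpow_mul]
  congr 2 <;> field_simp

/-- Pointwise multiplicative bound of the derivative by the maximal function and the fractional
oscillation of the derivative. -/
theorem enorm_fderiv_le_localMaximal_rpow_mul_rpow {E F : Type*} [NormedAddCommGroup E]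
    [NormedSpace ℝ E] [FiniteDimensional ℝ E] [MeasurableSpace E] [BorelSpace E] [Nontrivial E]
    [NormedAddCommGroup F] [NormedSpace ℝ F] [FiniteDimensional ℝ F] (μ : Measure E)
    [μ.IsAddHaarMeasure] {f : E → F} {U : Set E} {x : E} {δ p s : ℝ} (hδ : 0 < δ) (hδ1 : δ ≤ 1)
    (hU : Metric.ball x δ ⊆ U) (hf : ContDiffOn ℝ 1 f U) (hp : 1 < p) (hs : 1 < s)
    {H : ℝ≥0∞} (hHt : H ≠ ⊤)
    (hH : H = (∫⁻ y in U, ‖fderiv ℝ f x - fderiv ℝ f y‖ₑ ^ p /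
      edist x y ^ ((Module.finrank ℝ E : ℝ) + (s - 1) * p) ∂μ) ^ (1 / p) +
        ENNReal.ofReal δ ^ (1 - s) * ‖fderiv ℝ f x‖ₑ) :
    ‖fderiv ℝ f x‖ₑ ≤ 2 * (2 ^ (Module.finrank ℝ E + 2) *
      (1 + (μ (Metric.ball 0 1))⁻¹ ^ (1 / p))) *
        (localMaximal μ (U.indicator fun y => ‖f y‖ₑ) x ^ ((s - 1) / s) * H ^ (1 / s)) := by
  have hp0 : 0 < p := by linarith
  have hδ0 : ENNReal.ofReal δ ≠ 0 := by simpa using hδ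
  have hδt : ENNReal.ofReal δ ≠ ⊤ := ENNReal.ofReal_ne_top
  set a := ‖fderiv ℝ f x‖ₑ
  set ω := (μ (Metric.ball 0 1))⁻¹ ^ (1 / p) with hω
  have hωt : ω ≠ ⊤ := ENNReal.rpow_ne_top_of_nonneg (by positivity)
    (ENNReal.inv_ne_top.2 (Metric.measure_ball_pos μ _ one_pos).ne')
  set D := (2 : ℝ≥0∞) ^ (Module.finrank ℝ E + 2) with hD
  have hD1 : 1 ≤ D := one_le_pow₀ (by norm_num)
  set M := localMaximal μ (U.indicator fun y => ‖f y‖ₑ) x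
  have hcancel : ENNReal.ofReal δ ^ (s - 1) * ENNReal.ofReal δ ^ (1 - s) = 1 := by
    rw [← ENNReal.rpow_add _ _ hδ0 hδt]; simp
  have haH : a ≤ ENNReal.ofReal δ ^ (s - 1) * H := by
    rw [hH, mul_add, ← mul_assoc, hcancel, one_mul]
    exact le_add_self
  refine ENNReal.le_rpow_mul_rpow_of_forall_le hs
    (ENNReal.mul_ne_top (by simp [hD]) (ENNReal.add_ne_top.2 ⟨by simp, hωt⟩)) hHt haH ?_
  intro R hR
  rcases le_total δ R with hRδ | hRδ
  · calc a ≤ ENNReal.ofReal δ ^ (s - 1) * H := haH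
      _ ≤ ENNReal.ofReal R ^ (s - 1) * H := by
          gcongr
      _ ≤ (ENNReal.ofReal R)⁻¹ * M + ENNReal.ofReal R ^ (s - 1) * H := le_add_self
      _ ≤ _ := le_mul_of_one_le_left zero_le (one_le_mul hD1 le_self_add)
  · have hRU : Metric.ball x R ⊆ U := (Metric.ball_subset_ball hRδ).trans hU
    have hM : (μ (Metric.ball x R))⁻¹ * ∫⁻ y in Metric.ball x R, ‖f y‖ₑ ∂μ ≤ M := by
      refine le_trans (le_of_eq ?_) (average_le_localMaximal μ _ x hR (hRδ.trans hδ1))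
      congr 1
      refine setLIntegral_congr_fun Metric.isOpen_ball.measurableSet fun y hy => ?_
      simp [hRU hy]
    have hG : (μ (Metric.ball x R))⁻¹ *
        ∫⁻ y in Metric.ball x R, ‖fderiv ℝ f y - fderiv ℝ f x‖ₑ ∂μ ≤
        ω * (ENNReal.ofReal R ^ (s - 1) * H) := by
      simp_rw [fun y => enorm_sub_rev (fderiv ℝ f y) (fderiv ℝ f x)]
      have hmeas : Measurable fun y => ‖fderiv ℝ f x - fderiv ℝ f y‖ₑ :=
        ((measurable_fderiv ℝ f).const_sub _).enorm
      refine (average_le_rpow_mul_lintegral_div μ hmeas (by rw [sub_self, ← ofReal_norm, norm_zero, ENNReal.ofReal_zero]) hR hp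
        (sub_pos.2 hs)).trans ?_
      gcongr
      rw [hH]
      refine le_trans ?_ le_self_add
      gcongr
    calc a ≤ _ := enorm_le_average_add_average_fderiv_sub μ hR (hf.mono hRU) _
      _ ≤ D * ((ENNReal.ofReal R)⁻¹ * M + ω * (ENNReal.ofReal R ^ (s - 1) * H)) := by gcongr
      _ ≤ D * ((1 + ω) * ((ENNReal.ofReal R)⁻¹ * M) +
            (1 + ω) * (ENNReal.ofReal R ^ (s - 1) * H)) := by
          gcongr D * (?_ + ?_ * _)
          · exact le_mul_of_one_le_left zero_le le_self_add
          · exact le_add_self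
      _ = _ := by ring

theorem measurable_lintegral_gagliardo {n N : ℕ} (U : Set (EuclideanSpace ℝ (Fin n)))
    (f : EuclideanSpace ℝ (Fin n) → EuclideanSpace ℝ (Fin N)) (p k : ℝ) :
    Measurable fun x => ∫⁻ y in U, ‖fderiv ℝ f x - fderiv ℝ f y‖ₑ ^ p / edist x y ^ k := by
  have hDf := measurable_fderiv ℝ f
  refine Measurable.lintegral_prod_right' (f := fun z : EuclideanSpace ℝ (Fin n) × _ =>
    ‖fderiv ℝ f z.1 - fderiv ℝ f z.2‖ₑ ^ p / edist z.1 z.2 ^ k) ?_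
  exact (((hDf.comp measurable_fst).sub (hDf.comp measurable_snd)).enorm.pow_const p).div
    ((measurable_fst.edist measurable_snd).pow_const _)

/-- The fractional oscillation of `fderiv ℝ f`, completed by the lower order term, is controlled
in `L^p` by the `W^{s,p}` norm. -/
theorem lintegral_oscillation_le_wNormOn {n N : ℕ} {U V : Set (EuclideanSpace ℝ (Fin n))}
    (hVU : V ⊆ U) (f : EuclideanSpace ℝ (Fin n) → EuclideanSpace ℝ (Fin N)) {p s δ : ℝ}
    (hδ : 0 < δ) (hδ1 : δ ≤ 1) (hp : 1 < p) (hs : 1 < s) :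
    (∫⁻ x in V, ((∫⁻ y in U, ‖fderiv ℝ f x - fderiv ℝ f y‖ₑ ^ p /
      edist x y ^ ((n : ℝ) + (s - 1) * p)) ^ (1 / p) +
        ENNReal.ofReal δ ^ (1 - s) * ‖fderiv ℝ f x‖ₑ) ^ p) ^ (1 / p) ≤
      ENNReal.ofReal δ ^ (1 - s) * wNormOn U f s p := by
  have hp0 : 0 < p := by linarith
  have hDf := measurable_fderiv ℝ f
  have hδ1' : 1 ≤ ENNReal.ofReal δ ^ (1 - s) := by
    rw [← neg_sub, ENNReal.rpow_neg, ENNReal.one_le_inv]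
    exact ENNReal.rpow_le_one (by simpa using hδ1) (by linarith)
  have hδt : ENNReal.ofReal δ ^ (1 - s) ≠ ⊤ :=
    ENNReal.rpow_ne_top_of_ne_zero (by simpa using hδ) ENNReal.ofReal_ne_top
  refine (ENNReal.lintegral_Lp_add_le ((measurable_lintegral_gagliardo U f p _).pow_const _).aemeasurable
    (hDf.enorm.const_mul _).aemeasurable hp.le).trans ?_
  have h1 : (∫⁻ x in V, ((∫⁻ y in U, ‖fderiv ℝ f x - fderiv ℝ f y‖ₑ ^ p /
      edist x y ^ ((n : ℝ) + (s - 1) * p)) ^ (1 / p)) ^ p) ^ (1 / p) ≤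
      gagliardoSeminorm U (fun x => fderiv ℝ f x) (s - 1) p := by
    simp_rw [← ENNReal.rpow_mul, one_div_mul_cancel hp0.ne', ENNReal.rpow_one]
    exact ENNReal.rpow_le_rpow (lintegral_mono_set hVU) (by positivity)
  have h2 : (∫⁻ x in V, (ENNReal.ofReal δ ^ (1 - s) * ‖fderiv ℝ f x‖ₑ) ^ p) ^ (1 / p) ≤
      ENNReal.ofReal δ ^ (1 - s) * lpNormOn U (fun x => fderiv ℝ f x) p := by
    simp_rw [ENNReal.mul_rpow_of_nonneg _ _ hp0.le]
    rw [lintegral_const_mul' _ _ (ENNReal.rpow_ne_top_of_nonneg hp0.le hδt),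
      ENNReal.mul_rpow_of_nonneg _ _ (by positivity), ← ENNReal.rpow_mul,
      mul_one_div_cancel hp0.ne', ENNReal.rpow_one]
    gcongr
    exact ENNReal.rpow_le_rpow (lintegral_mono_set hVU) (by positivity)
  calc _ ≤ gagliardoSeminorm U (fun x => fderiv ℝ f x) (s - 1) p +
        ENNReal.ofReal δ ^ (1 - s) * lpNormOn U (fun x => fderiv ℝ f x) p := add_le_add h1 h2
    _ ≤ ENNReal.ofReal δ ^ (1 - s) * gagliardoSeminorm U (fun x => fderiv ℝ f x) (s - 1) p +
        ENNReal.ofReal δ ^ (1 - s) * lpNormOn U (fun x => fderiv ℝ f x) p := by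
        gcongr
        exact le_mul_of_one_le_left zero_le hδ1'
    _ ≤ _ := by
        rw [← mul_add, wNormOn]
        gcongr ENNReal.ofReal δ ^ (1 - s) * ?_
        rw [add_comm]
        exact add_le_add le_add_self le_rfl

/-- Interpolation of the derivative on the smaller ball, with an explicit constant. -/
theorem lpNormOn_fderiv_le {n N : ℕ} (hn : 1 ≤ n) {p q s P : ℝ} (hp : 1 < p) (hq : 1 < q)
    (hs : 1 < s) (hP : 0 < P) (hPpq : (s - 1) / s * P / q + 1 / s * P / p = 1)
    {x₀ : EuclideanSpace ℝ (Fin n)} {ϱ r : ℝ} (hϱ : 0 < ϱ) (hϱr : ϱ < r) (hr : r ≤ 1)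
    {f : EuclideanSpace ℝ (Fin n) → EuclideanSpace ℝ (Fin N)}
    (hf : ContDiffOn ℝ 1 f (Metric.ball x₀ r)) (hW : wNormOn (Metric.ball x₀ r) f s p < ⊤) :
    lpNormOn (Metric.ball x₀ ϱ) (fun x => fderiv ℝ f x) P ≤
      2 * (2 ^ (n + 2) * (1 + (volume (Metric.ball (0 : EuclideanSpace ℝ (Fin n)) 1))⁻¹ ^
        (1 / p))) * (ENNReal.ofReal (q / (q - 1) * 2 ^ q * 5 ^ n) ^ (1 / q)) ^ ((s - 1) / s) *
      ENNReal.ofReal (r - ϱ) ^ (-((s - 1) / s)) *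
        lpNormOn (Metric.ball x₀ r) f q ^ ((s - 1) / s) *
        wNormOn (Metric.ball x₀ r) f s p ^ (1 / s) := by
  have : Nonempty (Fin n) := ⟨⟨0, hn⟩⟩
  have hs0 : 0 < s := by linarith
  have hs1 : 0 < s - 1 := by linarith
  have hp0 : 0 < p := by linarith
  have hq0 : 0 < q := by linarith
  have hδ : 0 < r - ϱ := sub_pos.2 hϱr
  have hδ1 : r - ϱ ≤ 1 := by linarith
  set U := Metric.ball x₀ r with hU
  set V := Metric.ball x₀ ϱ with hV
  have hVU : V ⊆ U := Metric.ball_subset_ball hϱr.le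
  have hUo : IsOpen U := Metric.isOpen_ball
  have hVm : MeasurableSet V := Metric.isOpen_ball.measurableSet
  set K : ℝ≥0∞ := 2 * (2 ^ (n + 2) *
    (1 + (volume (Metric.ball (0 : EuclideanSpace ℝ (Fin n)) 1))⁻¹ ^ (1 / p))) with hK
  have hKt : K ≠ ⊤ := by
    refine ENNReal.mul_ne_top (by simp) (ENNReal.mul_ne_top (by simp) (ENNReal.add_ne_top.2
      ⟨by simp, ENNReal.rpow_ne_top_of_nonneg (by positivity)
        (ENNReal.inv_ne_top.2 (Metric.measure_ball_pos volume _ one_pos).ne')⟩))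
  set g := U.indicator fun y => ‖f y‖ₑ with hg
  have hgm : Measurable g := by
    classical
    rw [hg, ← Set.piecewise_eq_indicator]
    exact ContinuousOn.measurable_piecewise hf.continuousOn.enorm continuousOn_const
      hUo.measurableSet
  set M := localMaximal volume g
  have hMm : Measurable M := measurable_localMaximal volume g
  have hDf := measurable_fderiv ℝ f
  set H : EuclideanSpace ℝ (Fin n) → ℝ≥0∞ := fun x =>
    (∫⁻ y in U, ‖fderiv ℝ f x - fderiv ℝ f y‖ₑ ^ p /
      edist x y ^ ((n : ℝ) + (s - 1) * p)) ^ (1 / p) +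
        ENNReal.ofReal (r - ϱ) ^ (1 - s) * ‖fderiv ℝ f x‖ₑ with hH
  have hHm : Measurable H :=
    ((measurable_lintegral_gagliardo U f p _).pow_const _).add (hDf.enorm.const_mul _)
  have hHW : (∫⁻ x in V, H x ^ p) ^ (1 / p) ≤
      ENNReal.ofReal (r - ϱ) ^ (1 - s) * wNormOn U f s p :=
    lintegral_oscillation_le_wNormOn hVU f hδ hδ1 hp hs
  have hHfin : ∀ᵐ x ∂volume.restrict V, H x ≠ ⊤ := by
    have hlt : ∫⁻ x in V, H x ^ p ≠ ⊤ := by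
      intro htop
      rw [htop, ENNReal.top_rpow_of_pos (by positivity)] at hHW
      exact (ENNReal.mul_lt_top (ENNReal.rpow_ne_top_of_ne_zero (by simpa using hδ)
        ENNReal.ofReal_ne_top).lt_top hW).not_ge hHW
    filter_upwards [ae_lt_top (hHm.pow_const p) hlt] with x hx htop
    rw [htop, ENNReal.top_rpow_of_pos hp0] at hx
    exact lt_irrefl _ hx
  have hpt : ∀ᵐ x ∂volume.restrict V,
      ‖fderiv ℝ f x‖ₑ ≤ K * (M x ^ ((s - 1) / s) * H x ^ (1 / s)) := by
    filter_upwards [hHfin, ae_restrict_mem hVm] with x hx hxV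
    have hsub : Metric.ball x (r - ϱ) ⊆ U := by
      refine Metric.ball_subset_ball' ?_
      have := Metric.mem_ball.1 hxV
      linarith
    have := enorm_fderiv_le_localMaximal_rpow_mul_rpow (volume : Measure (EuclideanSpace ℝ (Fin n)))
      hδ hδ1 hsub hf hp hs hx (by rw [hH, finrank_euclideanSpace_fin])
    rwa [finrank_euclideanSpace_fin] at this
  have hMle : (∫⁻ x in V, M x ^ q) ^ (1 / q) ≤
      ENNReal.ofReal (q / (q - 1) * 2 ^ q * 5 ^ n) ^ (1 / q) * lpNormOn U f q := by
    have h1 := lintegral_localMaximal_rpow_le (volume : Measure (EuclideanSpace ℝ (Fin n))) hgm hq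
    rw [finrank_euclideanSpace_fin] at h1
    have h2 : ∫⁻ x, g x ^ q = ∫⁻ x in U, ‖f x‖ₑ ^ q := by
      rw [← lintegral_indicator hUo.measurableSet]
      refine lintegral_congr fun x => ?_
      by_cases hx : x ∈ U <;> simp [hg, hx, hq0]
    rw [h2] at h1
    have h3 := ENNReal.rpow_le_rpow ((setLIntegral_le_lintegral V _).trans h1)
      (by positivity : 0 ≤ 1 / q)
    rwa [ENNReal.mul_rpow_of_nonneg _ _ (by positivity)] at h3
  have hδpow : (ENNReal.ofReal (r - ϱ) ^ (1 - s)) ^ (1 / s) =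
      ENNReal.ofReal (r - ϱ) ^ (-((s - 1) / s)) := by
    rw [← ENNReal.rpow_mul]
    congr 1
    ring
  calc lpNormOn V (fun x => fderiv ℝ f x) P
      ≤ (∫⁻ x in V, (K * (M x ^ ((s - 1) / s) * H x ^ (1 / s))) ^ P) ^ (1 / P) := by
        refine ENNReal.rpow_le_rpow (lintegral_mono_ae ?_) (by positivity)
        filter_upwards [hpt] with x hx
        exact ENNReal.rpow_le_rpow hx hP.le
    _ = K * (∫⁻ x in V, (M x ^ ((s - 1) / s) * H x ^ (1 / s)) ^ P) ^ (1 / P) := by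
        simp_rw [ENNReal.mul_rpow_of_nonneg K _ hP.le]
        rw [lintegral_const_mul' _ _ (ENNReal.rpow_ne_top_of_nonneg hP.le hKt),
          ENNReal.mul_rpow_of_nonneg _ _ (by positivity), ← ENNReal.rpow_mul,
          mul_one_div_cancel hP.ne', ENNReal.rpow_one]
    _ ≤ K * (((∫⁻ x in V, M x ^ q) ^ (1 / q)) ^ ((s - 1) / s) *
          ((∫⁻ x in V, H x ^ p) ^ (1 / p)) ^ (1 / s)) := by
        gcongr K * ?_
        exact lintegral_rpow_mul_rpow_interpolation hMm.aemeasurable hHm.aemeasurable hq0 hp0 hP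
          (by positivity) (by positivity) hPpq
    _ ≤ K * ((ENNReal.ofReal (q / (q - 1) * 2 ^ q * 5 ^ n) ^ (1 / q) * lpNormOn U f q) ^
          ((s - 1) / s) * (ENNReal.ofReal (r - ϱ) ^ (1 - s) * wNormOn U f s p) ^ (1 / s)) := by
        gcongr
    _ = _ := by
        rw [ENNReal.mul_rpow_of_nonneg _ _ (by positivity : 0 ≤ (s - 1) / s),
          ENNReal.mul_rpow_of_nonneg _ _ (by positivity : 0 ≤ 1 / s), hδpow]
        ring

theorem lpNormOn_mono_set {n : ℕ} {F : Type*} [NormedAddCommGroup F]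
    {V U : Set (EuclideanSpace ℝ (Fin n))} (h : V ⊆ U) (g : EuclideanSpace ℝ (Fin n) → F) {p : ℝ}
    (hp : 0 ≤ p) : lpNormOn V g p ≤ lpNormOn U g p :=
  ENNReal.rpow_le_rpow (lintegral_mono_set h) (by positivity)

theorem lpNormOn_interpolation {n N : ℕ} {U : Set (EuclideanSpace ℝ (Fin n))} (hU : IsOpen U)
    {f : EuclideanSpace ℝ (Fin n) → EuclideanSpace ℝ (Fin N)} (hf : ContinuousOn f U)
    {p q P θ η : ℝ} (hp : 0 < p) (hq : 0 < q) (hP : 0 < P) (hθ : 0 ≤ θ) (hη : 0 ≤ η)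
    (hsum : η + θ = 1) (h : η * P / q + θ * P / p = 1) :
    lpNormOn U f P ≤ lpNormOn U f q ^ η * lpNormOn U f p ^ θ := by
  have hfm : AEMeasurable (fun x => ‖f x‖ₑ) (volume.restrict U) :=
    (hf.aemeasurable hU.measurableSet).enorm
  have key := lintegral_rpow_mul_rpow_interpolation hfm hfm hq hp hP hθ hη h
  simp_rw [← ENNReal.rpow_add_of_nonneg _ _ hη hθ, hsum, ENNReal.rpow_one] at key
  exact key

/-- Localized fractional Gagliardo–Nirenberg interpolation inequality (Lemma 3.1):
for concentric balls `B_ϱ ⋐ B_r ⊂ ℝⁿ` with `r ≤ 1` and `f ∈ W^{s,p} ∩ L^{2t}(B_r, ℝᴺ)`,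
with `p̃ = 2pst/(p(s-1)+2t)`,
`‖f‖_{W^{1,p̃}(B_ϱ)} ≤ c (r-ϱ)^{-κ} ‖f‖_{L^{2t}(B_r)}^{(s-1)/s} ‖f‖_{W^{s,p}(B_r)}^{1/s}`. -/
theorem stmt_3 (n : ℕ) (p s t : ℝ) (hn : 1 ≤ n) (hp : 1 < p)
    (hs : s ∈ Set.Ioo (1 : ℝ) 2) (ht : 1 < t) :
    ∃ c κ : ℝ, 0 < c ∧ 0 < κ ∧
      ∀ (N : ℕ) (_ : 1 ≤ N) (x₀ : EuclideanSpace ℝ (Fin n)) (ϱ r : ℝ)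
        (f : EuclideanSpace ℝ (Fin n) → EuclideanSpace ℝ (Fin N)),
        0 < ϱ → ϱ < r → r ≤ 1 →
        ContDiffOn ℝ 1 f (Metric.ball x₀ r) →
        wNormOn (Metric.ball x₀ r) f s p < ⊤ →
        lpNormOn (Metric.ball x₀ r) f (2 * t) < ⊤ →
        lpNormOn (Metric.ball x₀ ϱ) f (2 * p * s * t / (p * (s - 1) + 2 * t)) +
            lpNormOn (Metric.ball x₀ ϱ) (fun x => fderiv ℝ f x)
              (2 * p * s * t / (p * (s - 1) + 2 * t)) ≤
          ENNReal.ofReal (c * (r - ϱ) ^ (-κ)) *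
            (lpNormOn (Metric.ball x₀ r) f (2 * t)) ^ ((s - 1) / s) *
            (wNormOn (Metric.ball x₀ r) f s p) ^ (1 / s) := by
  obtain ⟨hs1, -⟩ := hs
  have hs0 : 0 < s := by linarith
  have hs1' : 0 < s - 1 := by linarith
  have hp0 : 0 < p := by linarith
  have ht0 : 0 < t := by linarith
  set P := 2 * p * s * t / (p * (s - 1) + 2 * t) with hPdef
  have hP : 0 < P := by positivity
  have hPpq : (s - 1) / s * P / (2 * t) + 1 / s * P / p = 1 := by
    have hden : p * (s - 1) + 2 * t ≠ 0 := by positivity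
    rw [hPdef]
    field_simp
  set C : ℝ≥0∞ := 2 * (2 ^ (n + 2) *
    (1 + (volume (Metric.ball (0 : EuclideanSpace ℝ (Fin n)) 1))⁻¹ ^ (1 / p))) *
    (ENNReal.ofReal (2 * t / (2 * t - 1) * 2 ^ (2 * t) * 5 ^ n) ^ (1 / (2 * t))) ^
      ((s - 1) / s) with hC
  have hCt : C ≠ ⊤ := by
    refine ENNReal.mul_ne_top (ENNReal.mul_ne_top (by simp) (ENNReal.mul_ne_top (by simp)
      (ENNReal.add_ne_top.2 ⟨by simp, ENNReal.rpow_ne_top_of_nonneg (by positivity)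
        (ENNReal.inv_ne_top.2 (Metric.measure_ball_pos volume _ one_pos).ne')⟩))) ?_
    exact ENNReal.rpow_ne_top_of_nonneg (by positivity)
      (ENNReal.rpow_ne_top_of_nonneg (by positivity) ENNReal.ofReal_ne_top)
  have h1Ct : 1 + C ≠ ⊤ := ENNReal.add_ne_top.2 ⟨by simp, hCt⟩
  refine ⟨(1 + C).toReal, (s - 1) / s, ENNReal.toReal_pos (by simp) h1Ct, by positivity, ?_⟩
  intro N _ x₀ ϱ r f hϱ hϱr hr hf hW _
  have hδ : 0 < r - ϱ := sub_pos.2 hϱr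
  rw [ENNReal.ofReal_mul ENNReal.toReal_nonneg, ENNReal.ofReal_toReal h1Ct,
    ← ENNReal.ofReal_rpow_of_pos hδ]
  have hDf := lpNormOn_fderiv_le hn hp (by linarith : 1 < 2 * t) hs1 hP hPpq hϱ hϱr hr hf hW
  rw [← hC] at hDf
  have hδ1 : 1 ≤ ENNReal.ofReal (r - ϱ) ^ (-((s - 1) / s)) := by
    rw [ENNReal.rpow_neg, ENNReal.one_le_inv]
    refine ENNReal.rpow_le_one ?_ (by positivity)
    simp only [ENNReal.ofReal_le_one]
    linarith
  set Q := ENNReal.ofReal (r - ϱ) ^ (-((s - 1) / s))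
  set L := lpNormOn (Metric.ball x₀ r) f (2 * t) ^ ((s - 1) / s)
  set W := wNormOn (Metric.ball x₀ r) f s p ^ (1 / s)
  have hf0 : lpNormOn (Metric.ball x₀ ϱ) f P ≤ L * W := by
    calc lpNormOn (Metric.ball x₀ ϱ) f P ≤ lpNormOn (Metric.ball x₀ r) f P :=
          lpNormOn_mono_set (Metric.ball_subset_ball hϱr.le) f hP.le
      _ ≤ L * lpNormOn (Metric.ball x₀ r) f p ^ (1 / s) :=
          lpNormOn_interpolation Metric.isOpen_ball hf.continuousOn hp0 (by positivity) hP
            (by positivity) (by positivity) (by field_simp; ring) hPpq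
      _ ≤ L * W := by
          gcongr L * ?_
          refine ENNReal.rpow_le_rpow ?_ (by positivity)
          rw [wNormOn, add_assoc]
          exact le_self_add
  calc _ ≤ L * W + C * Q * L * W := add_le_add hf0 hDf
    _ ≤ Q * (L * W) + C * Q * L * W :=
        add_le_add (le_mul_of_one_le_left zero_le hδ1) le_rfl
    _ = (1 + C) * Q * L * W := by ring
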